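/- Let d ≥ 200 and let ρ and σ be density matrices on ℂ^d. For a unitary U ∈ U(d) with columns u_1, …, u_d, with probability at least 0.9 over U drawn from the Haar measure μ on U(d), one has Σ_{x=1}^d |⟨u_x, (ρ − σ) u_x⟩| ≥ (0.0049/(3e)) · √(Tr((ρ−σ)²)) / ln(d). Equivalently, the ℓ₁ distance between the outcome distributions of the Haar-random basis measurement applied to ρ and to σ is at least a universal constant times ‖ρ−σ‖_F / ln(d) with probability at least 0.9. -/

import Mathlib

open Matrix MeasureTheory
open scoped BigOperators ComplexOrder

variable {n : Type*} [Fintype n] [DecidableEq n]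

section
open scoped Matrix.Norms.Frobenius

theorem exists_unitary_flow (X : Matrix n n ℂ) (hX : Xᴴ = -X) :
    ∃ V : ℝ → unitaryGroup n ℂ, V 0 = 1 ∧ (∀ s t, V (s + t) = V s * V t) ∧
      ∀ i j, HasDerivAt (fun t => (V t : Matrix n n ℂ) i j) (X i j) 0 := by
  have hstar (t : ℝ) : star (NormedSpace.exp (t • X)) = NormedSpace.exp (-(t • X)) := by
    rw [NormedSpace.star_exp]
    congr 1
    rw [star_smul, star_eq_conjTranspose, hX]; simp
  refine ⟨fun t => ⟨NormedSpace.exp (t • X), ?_⟩, ?_, ?_, ?_⟩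
  · rw [mem_unitaryGroup_iff, hstar, ← Matrix.exp_add_of_commute]
    · simp
    · exact (Commute.refl _).neg_right
  · ext; simp
  · intro s t
    apply Subtype.ext
    simp only [add_smul]
    exact Matrix.exp_add_of_commute _ _ (((Commute.refl X).smul_left s).smul_right t)
  · intro i j
    have h := hasDerivAt_exp_smul_const (𝕂 := ℝ) X 0
    simp at h
    have := (hasDerivAt_pi.1 h i)
    exact (hasDerivAt_pi.1 this j)
end

instance compactSpace_unitaryGroup : CompactSpace (unitaryGroup n ℂ) := by
  refine isCompact_iff_compactSpace (s := (unitaryGroup n ℂ : Set (Matrix n n ℂ))).1 ?_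
  refine IsCompact.of_isClosed_subset
    (isCompact_univ_pi fun _ => isCompact_univ_pi fun _ => isCompact_closedBall (0 : ℂ) 1)
    (isClosed_unitary (R := Matrix n n ℂ)) fun U hU => ?_
  intro i _ j _
  simpa using entry_norm_bound_of_unitary hU i j

/-- The conjugate `U * C * Uᴴ` of a matrix `C` by a unitary `U`. -/
def unitaryConj (C : Matrix n n ℂ) (U : unitaryGroup n ℂ) : Matrix n n ℂ :=
  (U : Matrix n n ℂ) * C * (U : Matrix n n ℂ)ᴴ

@[fun_prop]
theorem continuous_unitaryConj (C : Matrix n n ℂ) : Continuous (unitaryConj C) := by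
  unfold unitaryConj
  fun_prop

theorem unitaryConj_mul (C : Matrix n n ℂ) (V U : unitaryGroup n ℂ) :
    unitaryConj C (V * U) = (V : Matrix n n ℂ) * unitaryConj C U * (V : Matrix n n ℂ)ᴴ := by
  simp [unitaryConj, conjTranspose_mul, mul_assoc]

theorem trace_unitaryConj (C : Matrix n n ℂ) (U : unitaryGroup n ℂ) :
    trace (unitaryConj C U) = trace C := by
  rw [unitaryConj, trace_mul_cycle, ← star_eq_conjTranspose]
  simp

/-- `HasLieGradient g G` says that the derivative of `g` at `U` along `V t * U`, for a one-parameter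
group `V` of unitaries with generator `X`, is `Tr (X * G U)`. -/
structure HasLieGradient (g : unitaryGroup n ℂ → ℂ) (G : unitaryGroup n ℂ → Matrix n n ℂ) :
    Prop where
  continuous : Continuous g
  continuous_gradient : Continuous G
  hasDerivAt : ∀ (X : Matrix n n ℂ) (V : ℝ → unitaryGroup n ℂ), Xᴴ = -X → V 0 = 1 →
    (∀ i j, HasDerivAt (fun t => (V t : Matrix n n ℂ) i j) (X i j) 0) →
    ∀ U, HasDerivAt (fun t => g (V t * U)) (trace (X * G U)) 0

namespace HasLieGradient

theorem mul {g₁ g₂ : unitaryGroup n ℂ → ℂ} {G₁ G₂ : unitaryGroup n ℂ → Matrix n n ℂ}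
    (h₁ : HasLieGradient g₁ G₁) (h₂ : HasLieGradient g₂ G₂) :
    HasLieGradient (fun U => g₁ U * g₂ U) (fun U => g₂ U • G₁ U + g₁ U • G₂ U) where
  continuous := h₁.continuous.mul h₂.continuous
  continuous_gradient := (h₂.continuous.smul h₁.continuous_gradient).add
    (h₁.continuous.smul h₂.continuous_gradient)
  hasDerivAt X V hX hV0 hV U := by
    have := (h₁.hasDerivAt X V hX hV0 hV U).mul (h₂.hasDerivAt X V hX hV0 hV U)
    refine this.congr_deriv ?_
    simp [hV0, mul_add, trace_add, trace_smul]
    ring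

theorem sum {ι : Type*} (s : Finset ι) {g : ι → unitaryGroup n ℂ → ℂ}
    {G : ι → unitaryGroup n ℂ → Matrix n n ℂ} (h : ∀ y ∈ s, HasLieGradient (g y) (G y)) :
    HasLieGradient (fun U => ∑ y ∈ s, g y U) (fun U => ∑ y ∈ s, G y U) where
  continuous := continuous_finsetSum s fun y hy => (h y hy).continuous
  continuous_gradient := continuous_finsetSum s fun y hy => (h y hy).continuous_gradient
  hasDerivAt X V hX hV0 hV U := by
    have := HasDerivAt.fun_sum fun y hy => (h y hy).hasDerivAt X V hX hV0 hV U
    refine this.congr_deriv ?_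
    simp [Matrix.mul_sum, trace_sum]

theorem pow {g : unitaryGroup n ℂ → ℂ} {G : unitaryGroup n ℂ → Matrix n n ℂ}
    (h : HasLieGradient g G) (k : ℕ) :
    HasLieGradient (fun U => g U ^ k) (fun U => (k * g U ^ (k - 1)) • G U) where
  continuous := h.continuous.pow k
  continuous_gradient := (continuous_const.mul (h.continuous.pow _)).smul h.continuous_gradient
  hasDerivAt X V hX hV0 hV U := by
    have := (h.hasDerivAt X V hX hV0 hV U).fun_pow k
    refine this.congr_deriv ?_
    simp [hV0, trace_smul]

section
open scoped Matrix.Norms.Frobenius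

theorem trace_conj_mul (C M : Matrix n n ℂ) :
    HasLieGradient (fun U => trace (unitaryConj C U * M))
      (fun U => unitaryConj C U * M - M * unitaryConj C U) where
  continuous := by fun_prop
  continuous_gradient := by fun_prop
  hasDerivAt X V hX hV0 hV U := by
    have h : HasDerivAt (fun t => (V t : Matrix n n ℂ)) X 0 :=
      hasDerivAt_pi.2 fun i => hasDerivAt_pi.2 fun j => hV i j
    have h' : HasDerivAt (fun t => (V t : Matrix n n ℂ)ᴴ) (-X) 0 := by
      rw [← hX]
      exact hasDerivAt_pi.2 fun i => hasDerivAt_pi.2 fun j => (hV j i).star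
    have h2 := ((h.mul_const (unitaryConj C U)).mul h').mul_const M
    have h3 := HasDerivAt.fun_sum (u := Finset.univ) fun i _ =>
      hasDerivAt_pi.1 (hasDerivAt_pi.1 h2 i) i
    simp only [unitaryConj_mul]
    refine h3.congr_deriv ?_
    change trace _ = _
    rw [hV0, OneMemClass.coe_one, conjTranspose_one, one_mul, mul_one, mul_neg, ← sub_eq_add_neg,
      sub_mul, mul_sub, trace_sub, trace_sub, mul_assoc, ← mul_assoc X M, trace_mul_comm (X * M),
      ← mul_assoc _ X M]
end

end HasLieGradient

section
variable [MeasurableSpace (unitaryGroup n ℂ)] [BorelSpace (unitaryGroup n ℂ)]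
  {μ : Measure (unitaryGroup n ℂ)} [IsProbabilityMeasure μ]

theorem integrable_of_continuous_unitaryGroup {E : Type*} [NormedAddCommGroup E]
    {g : unitaryGroup n ℂ → E} (hg : Continuous g) : Integrable g μ :=
  hg.integrable_of_hasCompactSupport (.of_compactSpace g)

theorem HasLieGradient.integral_trace_eq_zero
    (hinv : ∀ V : unitaryGroup n ℂ, μ.map (fun U => V * U) = μ)
    {g : unitaryGroup n ℂ → ℂ} {G : unitaryGroup n ℂ → Matrix n n ℂ} (h : HasLieGradient g G)
    (X : Matrix n n ℂ) (hX : Xᴴ = -X) : ∫ U, trace (X * G U) ∂μ = 0 := by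
  obtain ⟨V, hV0, hadd, hV⟩ := exists_unitary_flow X hX
  have hcont : Continuous fun U => trace (X * G U) := by
    have := h.continuous_gradient
    fun_prop
  obtain ⟨C, hC⟩ := (isCompact_univ.image hcont).isBounded.exists_norm_le
  have hconst (t : ℝ) : ∫ U, g (V t * U) ∂μ = ∫ U, g U ∂μ := by
    conv_rhs => rw [← hinv (V t)]
    rw [integral_map (by fun_prop) h.continuous.measurable.aestronglyMeasurable]
  have key := (hasDerivAt_integral_of_dominated_loc_of_deriv_le (μ := μ) (𝕜 := ℝ) (x₀ := 0)
    (F := fun t U => g (V t * U)) (F' := fun t U => trace (X * G (V t * U)))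
    (bound := fun _ => C) Filter.univ_mem
    (.of_forall fun t => ?_) ?_ ?_ ?_ (integrable_const C) ?_).2
  · simp only [hconst, hV0, one_mul] at key
    exact key.unique (hasDerivAt_const _ _)
  · exact (h.continuous.comp (continuous_const_mul _)).measurable.aestronglyMeasurable
  · exact integrable_of_continuous_unitaryGroup (h.continuous.comp (continuous_const_mul _))
  · exact (hcont.comp (continuous_const_mul _)).measurable.aestronglyMeasurable
  · exact .of_forall fun U t _ => hC _ ⟨_, trivial, rfl⟩
  · refine .of_forall fun U t _ => ?_
    have h1 := h.hasDerivAt X V hX hV0 hV (V t * U)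
    rw [← sub_self t] at h1
    have h2 := h1.comp_sub_const t t
    refine h2.congr_of_eventuallyEq (.of_forall fun s => ?_)
    simp only
    rw [← mul_assoc, ← hadd, sub_add_cancel]

theorem HasLieGradient.integral_apply_eq_zero
    (hinv : ∀ V : unitaryGroup n ℂ, μ.map (fun U => V * U) = μ)
    {g : unitaryGroup n ℂ → ℂ} {G : unitaryGroup n ℂ → Matrix n n ℂ} (h : HasLieGradient g G)
    (i j : n) : ∫ U, G U i j ∂μ = 0 := by
  have hG (i j : n) : Integrable (fun U => G U i j) μ :=
    integrable_of_continuous_unitaryGroup (h.continuous_gradient.matrix_elem i j)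
  have h1 := h.integral_trace_eq_zero hinv (single j i 1 - single i j 1) (by simp)
  have h2 := h.integral_trace_eq_zero hinv (Complex.I • (single j i 1 + single i j 1)) (by
    simp [-smul_add, conjTranspose_smul]; abel)
  simp only [sub_mul, add_mul, smul_mul, trace_sub, trace_add, trace_smul, trace_single_mul,
    one_mul, smul_eq_mul] at h1 h2
  rw [integral_sub (hG _ _) (hG _ _)] at h1
  rw [integral_const_mul, integral_add (hG _ _) (hG _ _)] at h2
  have := (mul_eq_zero.1 h2).resolve_left Complex.I_ne_zero
  linear_combination (h1 + this) / 2

/-- The Schwinger-Dyson equation for a conjugated matrix `P = U * C * Uᴴ`. -/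
theorem HasLieGradient.integral_schwingerDyson
    (hinv : ∀ V : unitaryGroup n ℂ, μ.map (fun U => V * U) = μ) (C M : Matrix n n ℂ)
    {g : unitaryGroup n ℂ → ℂ} {G : unitaryGroup n ℂ → Matrix n n ℂ} (h : HasLieGradient g G) :
    ∫ U, ((Fintype.card n * trace (unitaryConj C U * M) - trace M * trace C) * g U
      + trace (unitaryConj C U * M * G U)) ∂μ = 0 := by
  have hij (i j : n) := ((trace_conj_mul C (M * single j i 1)).mul h).integral_apply_eq_zero hinv j i
  have hc := h.continuous
  have hC := h.continuous_gradient
  have hsum : ∫ U, ∑ i : n, ∑ j : n, (g U • (unitaryConj C U * (M * single j i 1)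
      - (M * single j i 1) * unitaryConj C U)
      + trace (unitaryConj C U * (M * single j i 1)) • G U : Matrix n n ℂ) j i ∂μ = 0 := by
    rw [integral_finsetSum]
    · refine Finset.sum_eq_zero fun i _ => ?_
      rw [integral_finsetSum]
      · exact Finset.sum_eq_zero fun j _ => hij i j
      · intro j _
        exact integrable_of_continuous_unitaryGroup (Continuous.matrix_elem (by fun_prop) _ _)
    · intro i _
      refine integrable_of_continuous_unitaryGroup (continuous_finsetSum _ fun j _ =>
        Continuous.matrix_elem (by fun_prop) _ _)
  rw [← hsum]
  congr 1 with U
  rw [← trace_unitaryConj C U]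
  set P := unitaryConj C U
  have e1 (i j : n) : (P * (M * single j i 1) : Matrix n n ℂ) j i = (P * M) j j := by
    rw [← mul_assoc]; simp
  have e2 (i j : n) : (M * single j i 1 * P : Matrix n n ℂ) j i = M j j * P i i := by
    rw [mul_assoc]; simp [Matrix.mul_apply, single_apply, ite_and]
  have e3 (i j : n) : trace (P * (M * single j i 1)) = (P * M) i j := by
    rw [← mul_assoc, trace_mul_single]; simp
  simp only [Matrix.add_apply, Matrix.smul_apply, Matrix.sub_apply, e1, e2, e3, smul_eq_mul,
    Finset.sum_add_distrib, ← Finset.mul_sum, Finset.sum_sub_distrib, ← Finset.sum_mul]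
  have e4 : ∑ i, ∑ j, (P * M) i j * G U j i = trace (P * M * G U) := by
    simp [trace, Matrix.mul_apply (M := P * M)]
  rw [e4]
  simp only [trace, diag_apply, Finset.sum_const, Finset.card_univ, nsmul_eq_mul]
  ring


end

/-- The diagonal entry `⟨u_x, M u_x⟩` of `Uᴴ * M * U`, where `u_x` is the `x`-th column of `U`. -/
def overlap (M : Matrix n n ℂ) (x : n) (U : unitaryGroup n ℂ) : ℂ :=
  ((U : Matrix n n ℂ)ᴴ * M * (U : Matrix n n ℂ)) x x

@[fun_prop]
theorem continuous_overlap (M : Matrix n n ℂ) (x : n) : Continuous (overlap M x) := by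
  unfold overlap
  exact Continuous.matrix_elem (by fun_prop) _ _

theorem trace_unitaryConj_single_mul_mul (M N : Matrix n n ℂ) (x y : n) (U : unitaryGroup n ℂ) :
    trace (unitaryConj (single x x 1) U * M * (unitaryConj (single y y 1) U * N)) =
      ((U : Matrix n n ℂ)ᴴ * M * (U : Matrix n n ℂ)) x y *
        ((U : Matrix n n ℂ)ᴴ * N * (U : Matrix n n ℂ)) y x := by
  set V := (U : Matrix n n ℂ) with hV
  calc _ = trace (V * (single x x 1 * (Vᴴ * M * V) * single y y 1 * Vᴴ * N)) := by
        simp only [unitaryConj, mul_assoc, hV]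
    _ = trace (single x x 1 * ((Vᴴ * M * V) * single y y 1 * (Vᴴ * N * V))) := by
        rw [trace_mul_comm]
        simp only [mul_assoc]
    _ = _ := by
        rw [trace_single_mul, Matrix.mul_apply, Finset.sum_eq_single y]
        · simp
        · intro z _ hz
          rw [mul_single_apply_of_ne _ _ _ _ _ hz, zero_mul]
        · simp

theorem conjTranspose_mul_self_unitaryGroup (U : unitaryGroup n ℂ) :
    (U : Matrix n n ℂ)ᴴ * (U : Matrix n n ℂ) = 1 :=
  mem_unitaryGroup_iff'.1 U.2

theorem mul_conjTranspose_self_unitaryGroup (U : unitaryGroup n ℂ) :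
    (U : Matrix n n ℂ) * (U : Matrix n n ℂ)ᴴ = 1 :=
  mem_unitaryGroup_iff.1 U.2

theorem trace_unitaryConj_single_mul (M : Matrix n n ℂ) (x : n) (U : unitaryGroup n ℂ) :
    trace (unitaryConj (single x x 1) U * M) = overlap M x U := by
  rw [unitaryConj, mul_assoc, trace_mul_comm, ← mul_assoc, trace_mul_single]
  simp [overlap]

theorem trace_unitaryConj_single_mul_unitaryConj_single (M N : Matrix n n ℂ) (x y : n)
    (U : unitaryGroup n ℂ) :
    trace (unitaryConj (single x x 1) U * M * (N * unitaryConj (single y y 1) U)) =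
      if x = y then overlap (M * N) x U else 0 := by
  have h := trace_unitaryConj_single_mul_mul (M * N) 1 x y U
  rw [← mul_assoc, mul_assoc _ M N]
  rw [mul_one, mul_one, conjTranspose_mul_self_unitaryGroup] at h
  rw [h, one_apply]
  split_ifs with h1 h2 h2
  · subst h1; simp [overlap]
  · exact absurd h1.symm h2
  · exact absurd h2.symm h1
  · simp

theorem sum_overlap (M : Matrix n n ℂ) (U : unitaryGroup n ℂ) :
    ∑ x, overlap M x U = trace M := by
  change trace ((U : Matrix n n ℂ)ᴴ * M * (U : Matrix n n ℂ)) = _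
  rw [trace_mul_comm, ← mul_assoc, mul_conjTranspose_self_unitaryGroup, one_mul]

theorem hasLieGradient_overlap (M : Matrix n n ℂ) (x : n) :
    HasLieGradient (overlap M x) (fun U => unitaryConj (single x x 1) U * M
      - M * unitaryConj (single x x 1) U) := by
  simpa only [trace_unitaryConj_single_mul] using HasLieGradient.trace_conj_mul (single x x 1) M

theorem ofReal_re_overlap {A : Matrix n n ℂ} (hA : A.IsHermitian) (x : n) (U : unitaryGroup n ℂ) :
    ((overlap A x U).re : ℂ) = overlap A x U :=
  (isHermitian_conjTranspose_mul_mul (U : Matrix n n ℂ) hA).coe_re_apply_self x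

theorem overlap_sq {A : Matrix n n ℂ} (hA : A.IsHermitian) (x : n) (U : unitaryGroup n ℂ) :
    overlap (A ^ 2) x U = ∑ y, (Complex.normSq
      (((U : Matrix n n ℂ)ᴴ * A * (U : Matrix n n ℂ)) x y) : ℂ) := by
  have hB := isHermitian_conjTranspose_mul_mul (U : Matrix n n ℂ) hA
  set B := (U : Matrix n n ℂ)ᴴ * A * (U : Matrix n n ℂ) with hBdef
  have h : (U : Matrix n n ℂ)ᴴ * A ^ 2 * (U : Matrix n n ℂ) = B * B := by
    calc _ = (U : Matrix n n ℂ)ᴴ * A * 1 * (A * (U : Matrix n n ℂ)) := by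
          rw [pow_two]; simp only [mul_assoc, mul_one]
      _ = _ := by
          rw [← mul_conjTranspose_self_unitaryGroup U, hBdef]; simp only [mul_assoc]
  rw [overlap, h, Matrix.mul_apply]
  refine Finset.sum_congr rfl fun y _ => ?_
  rw [← hB.apply y x, Complex.star_def, Complex.mul_conj]

theorem ofReal_re_trace {m : Type*} [Fintype m] {A : Matrix m m ℂ} (hA : A.IsHermitian) :
    ((trace A).re : ℂ) = trace A := by
  rw [trace, Complex.re_sum, Complex.ofReal_sum]
  exact Finset.sum_congr rfl fun i _ => hA.coe_re_apply_self i

theorem re_trace_sq {B : Matrix n n ℂ} (hB : B.IsHermitian) :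
    (trace (B ^ 2)).re = ∑ i, ∑ j, ‖B i j‖ ^ 2 := by
  simp only [trace, diag_apply, pow_two B, Matrix.mul_apply, Complex.re_sum]
  refine Finset.sum_congr rfl fun i _ => Finset.sum_congr rfl fun j _ => ?_
  rw [← hB.apply j i, Complex.star_def, Complex.mul_conj, Complex.ofReal_re, Complex.normSq_eq_norm_sq]

section
open scoped Matrix.Norms.Frobenius

theorem re_trace_pow_four_le {A : Matrix n n ℂ} (hA : A.IsHermitian) :
    (trace (A ^ 4)).re ≤ (trace (A ^ 2)).re ^ 2 := by
  have key {B : Matrix n n ℂ} (hB : B.IsHermitian) : (trace (B ^ 2)).re = ‖B‖ ^ 2 := by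
    rw [re_trace_sq hB, frobenius_norm_def, ← Real.sqrt_eq_rpow, Real.sq_sqrt (by positivity)]
    simp
  rw [show A ^ 4 = (A ^ 2) ^ 2 by rw [← pow_mul], key (hA.pow 2), key hA, pow_two A]
  gcongr
  rw [pow_two ‖A‖]
  exact norm_mul_le A A
end

theorem sum_sum_mul_normSq_le {A : Matrix n n ℂ} (hA : A.IsHermitian) (U : unitaryGroup n ℂ) :
    -∑ x, ∑ y, (overlap A x U).re * (overlap A y U).re *
        Complex.normSq (((U : Matrix n n ℂ)ᴴ * A * (U : Matrix n n ℂ)) x y)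
      ≤ ∑ x, (overlap (A ^ 2) x U).re * (overlap A x U).re ^ 2 := by
  have hB := isHermitian_conjTranspose_mul_mul (U : Matrix n n ℂ) hA
  have hw (x : n) : (overlap (A ^ 2) x U).re = ∑ y, Complex.normSq
      (((U : Matrix n n ℂ)ᴴ * A * (U : Matrix n n ℂ)) x y) := by
    rw [overlap_sq hA, ← Complex.ofReal_sum, Complex.ofReal_re]
  set B := (U : Matrix n n ℂ)ᴴ * A * (U : Matrix n n ℂ)
  have hsymm (x y : n) : Complex.normSq (B y x) = Complex.normSq (B x y) := by
    rw [← hB.apply x y, Complex.star_def, Complex.normSq_conj]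
  have e1 : ∑ x, (overlap (A ^ 2) x U).re * (overlap A x U).re ^ 2
      = ∑ x, ∑ y, (overlap A x U).re ^ 2 * Complex.normSq (B x y) := by
    refine Finset.sum_congr rfl fun x _ => ?_
    rw [hw, mul_comm, Finset.mul_sum]
  have e2 : ∑ x, (overlap (A ^ 2) x U).re * (overlap A x U).re ^ 2
      = ∑ x, ∑ y, (overlap A y U).re ^ 2 * Complex.normSq (B x y) := by
    rw [e1, Finset.sum_comm]
    exact Finset.sum_congr rfl fun x _ => Finset.sum_congr rfl fun y _ => by rw [hsymm]
  have e3 : 0 ≤ ∑ x, ∑ y, ((overlap A x U).re + (overlap A y U).re) ^ 2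
      * Complex.normSq (B x y) :=
    Finset.sum_nonneg fun x _ => Finset.sum_nonneg fun y _ =>
      mul_nonneg (sq_nonneg _) (Complex.normSq_nonneg _)
  have e4 : ∑ x, ∑ y, ((overlap A x U).re + (overlap A y U).re) ^ 2 * Complex.normSq (B x y)
      = ∑ x, ∑ y, (overlap A x U).re ^ 2 * Complex.normSq (B x y)
        + ∑ x, ∑ y, (overlap A y U).re ^ 2 * Complex.normSq (B x y)
        + 2 * ∑ x, ∑ y, (overlap A x U).re * (overlap A y U).re * Complex.normSq (B x y) := by
    simp only [Finset.mul_sum (a := (2 : ℝ)), ← Finset.sum_add_distrib]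
    exact Finset.sum_congr rfl fun x _ => Finset.sum_congr rfl fun y _ => by ring
  rw [e4, ← e1, ← e2] at e3
  linarith

section
variable [MeasurableSpace (unitaryGroup n ℂ)] [BorelSpace (unitaryGroup n ℂ)]
  {μ : Measure (unitaryGroup n ℂ)} [IsProbabilityMeasure μ]

theorem integral_overlap_mul_pow (hinv : ∀ V : unitaryGroup n ℂ, μ.map (fun U => V * U) = μ)
    (A M : Matrix n n ℂ) (x : n) (k : ℕ) :
    (Fintype.card n + k) * ∫ U, overlap M x U * overlap A x U ^ k ∂μ =
      trace M * ∫ U, overlap A x U ^ k ∂μ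
        + k * ∫ U, overlap (M * A) x U * overlap A x U ^ (k - 1) ∂μ := by
  have h := ((hasLieGradient_overlap A x).pow k).integral_schwingerDyson hinv (single x x 1) M
  rw [← sub_eq_zero, ← h, ← integral_const_mul, ← integral_const_mul, ← integral_const_mul,
    ← integral_add, ← integral_sub]
  · congr 1 with U
    have h1 := trace_unitaryConj_single_mul_mul M A x x U
    have h2 := trace_unitaryConj_single_mul_unitaryConj_single M A x x U
    simp only [if_true] at h2
    rw [trace_unitaryConj_single_mul, trace_single_eq_same, Matrix.mul_smul, trace_smul, mul_sub,
      trace_sub, h1, h2]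
    change _ = _ + _ • (overlap M x U * overlap A x U - _)
    rw [smul_eq_mul]
    rcases k with - | k
    · simp
    · simp only [Nat.add_sub_cancel, pow_succ]
      push_cast
      ring
  all_goals exact integrable_of_continuous_unitaryGroup (by fun_prop)

theorem integral_re_overlap_pow_mul_pow
    (hinv : ∀ V : unitaryGroup n ℂ, μ.map (fun U => V * U) = μ)
    {A : Matrix n n ℂ} (hA : A.IsHermitian) (x : n) (j k : ℕ) :
    (Fintype.card n + k) * ∫ U, (overlap (A ^ j) x U).re * (overlap A x U).re ^ k ∂μ =
      (trace (A ^ j)).re * ∫ U, (overlap A x U).re ^ k ∂μ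
        + k * ∫ U, (overlap (A ^ (j + 1)) x U).re * (overlap A x U).re ^ (k - 1) ∂μ := by
  have htr := ofReal_re_trace (hA.pow j)
  apply Complex.ofReal_injective
  push_cast
  simp only [← integral_complex_ofReal]
  push_cast
  simp only [ofReal_re_overlap hA, ofReal_re_overlap (hA.pow _), htr]
  exact integral_overlap_mul_pow hinv A (A ^ j) x k

theorem integral_sum_overlap_sq_identity
    (hinv : ∀ V : unitaryGroup n ℂ, μ.map (fun U => V * U) = μ)
    {A : Matrix n n ℂ} (hA : trace A = 0) :
    ∫ U : unitaryGroup n ℂ, ((Fintype.card n + 1) * (∑ x, overlap A x U ^ 2) ^ 2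
      - trace (A ^ 2) * (∑ x, overlap A x U ^ 2)
      + 2 * ∑ x, (∑ y, overlap A x U * overlap A y U *
          (((U : Matrix n n ℂ)ᴴ * A * (U : Matrix n n ℂ)) x y *
            ((U : Matrix n n ℂ)ᴴ * A * (U : Matrix n n ℂ)) y x)
        - overlap (A ^ 2) x U * overlap A x U ^ 2)) ∂μ = 0 := by
  have h (x : n) := ((hasLieGradient_overlap A x).mul (HasLieGradient.sum Finset.univ
    fun y _ => (hasLieGradient_overlap A y).pow 2)).integral_schwingerDyson hinv (single x x 1) A
  rw [← Finset.sum_eq_zero (s := Finset.univ) fun x _ => h x, ← integral_finsetSum]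
  · congr 1 with U
    simp only [hA, Matrix.mul_add, Matrix.mul_smul, Matrix.mul_sum, Matrix.mul_sub, trace_add,
      trace_smul, trace_sum, trace_sub, trace_unitaryConj_single_mul,
      trace_unitaryConj_single_mul_mul, trace_unitaryConj_single_mul_unitaryConj_single,
      ← pow_two A, if_true, smul_eq_mul, zero_mul, sub_zero]
    have hdiag (x : n) : ((U : Matrix n n ℂ)ᴴ * A * (U : Matrix n n ℂ)) x x = overlap A x U := rfl
    simp only [hdiag, mul_sub, Finset.sum_sub_distrib, mul_ite, mul_zero, Finset.sum_ite_eq,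
      Finset.mem_univ, if_true, Finset.sum_add_distrib]
    rw [← sum_overlap (A ^ 2) U]
    set Q := ∑ x, overlap A x U ^ 2 with hQ
    have e1 : ∑ x, Fintype.card n * overlap A x U * (overlap A x U * Q)
        = Fintype.card n * Q ^ 2 := by
      calc _ = ∑ x, Fintype.card n * Q * overlap A x U ^ 2 :=
            Finset.sum_congr rfl fun x _ => by ring
        _ = _ := by rw [← Finset.mul_sum, ← hQ]; ring
    have e2 : ∑ x, Q * (overlap A x U * overlap A x U) = Q ^ 2 := by
      rw [pow_two, ← Finset.mul_sum, hQ]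
      simp only [pow_two]
    rw [e1, e2]
    have e3 : ∑ x, overlap A x U * ∑ y, (2 : ℕ) * overlap A y U ^ (2 - 1) *
          (((U : Matrix n n ℂ)ᴴ * A * (U : Matrix n n ℂ)) x y *
            ((U : Matrix n n ℂ)ᴴ * A * (U : Matrix n n ℂ)) y x)
        = 2 * ∑ x, ∑ y, overlap A x U * overlap A y U *
          (((U : Matrix n n ℂ)ᴴ * A * (U : Matrix n n ℂ)) x y *
            ((U : Matrix n n ℂ)ᴴ * A * (U : Matrix n n ℂ)) y x) := by
      simp only [Finset.mul_sum]
      exact Finset.sum_congr rfl fun x _ => Finset.sum_congr rfl fun y _ => by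
        push_cast; ring
    have e4 : ∑ x, overlap A x U * ((2 : ℕ) * overlap A x U ^ (2 - 1) * overlap (A ^ 2) x U)
        = 2 * ∑ x, overlap (A ^ 2) x U * overlap A x U ^ 2 := by
      rw [Finset.mul_sum]
      exact Finset.sum_congr rfl fun x _ => by push_cast; ring
    rw [e3, e4, ← Finset.mul_sum]
    ring
  · intro x _
    exact integrable_of_continuous_unitaryGroup (by unfold unitaryConj; fun_prop)

theorem integral_sum_re_overlap_sq_sq_le
    (hinv : ∀ V : unitaryGroup n ℂ, μ.map (fun U => V * U) = μ)
    {A : Matrix n n ℂ} (hA : A.IsHermitian) (htr : trace A = 0) :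
    (Fintype.card n + 1) * ∫ U, (∑ x, (overlap A x U).re ^ 2) ^ 2 ∂μ ≤
      (trace (A ^ 2)).re * ∫ U, ∑ x, (overlap A x U).re ^ 2 ∂μ
        + 4 * ∑ x, ∫ U, (overlap (A ^ 2) x U).re * (overlap A x U).re ^ 2 ∂μ := by
  have h := integral_sum_overlap_sq_identity hinv htr
  have htr2 := ofReal_re_trace (hA.pow 2)
  have hB (U : unitaryGroup n ℂ) (x y : n) :
      ((U : Matrix n n ℂ)ᴴ * A * (U : Matrix n n ℂ)) x y *
        ((U : Matrix n n ℂ)ᴴ * A * (U : Matrix n n ℂ)) y x =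
      (Complex.normSq (((U : Matrix n n ℂ)ᴴ * A * (U : Matrix n n ℂ)) x y) : ℂ) := by
    rw [← (isHermitian_conjTranspose_mul_mul (U : Matrix n n ℂ) hA).apply y x, Complex.star_def,
      Complex.mul_conj]
  have h' : ∫ U : unitaryGroup n ℂ, ((Fintype.card n + 1) * (∑ x, (overlap A x U).re ^ 2) ^ 2
      - (trace (A ^ 2)).re * (∑ x, (overlap A x U).re ^ 2)
      + 2 * ∑ x, (∑ y, (overlap A x U).re * (overlap A y U).re *
          Complex.normSq (((U : Matrix n n ℂ)ᴴ * A * (U : Matrix n n ℂ)) x y)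
        - (overlap (A ^ 2) x U).re * (overlap A x U).re ^ 2)) ∂μ = 0 := by
    apply Complex.ofReal_injective
    rw [← integral_complex_ofReal, Complex.ofReal_zero, ← h]
    congr 1 with U
    push_cast
    simp only [ofReal_re_overlap hA, ofReal_re_overlap (hA.pow 2), htr2, hB]
  rw [← integral_const_mul, ← integral_const_mul, ← integral_finsetSum, ← integral_const_mul,
    ← integral_add, ← sub_nonneg, ← integral_sub, ← neg_zero, ← h',
    ← integral_neg]
  · refine integral_mono ?_ ?_ fun U => ?_
    · refine (integrable_of_continuous_unitaryGroup ?_).neg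
      have (x y : n) : Continuous fun U : unitaryGroup n ℂ =>
          ((U : Matrix n n ℂ)ᴴ * A * (U : Matrix n n ℂ)) x y :=
        Continuous.matrix_elem (by fun_prop) _ _
      have := Complex.continuous_normSq
      fun_prop
    · exact integrable_of_continuous_unitaryGroup (by fun_prop)
    · have := sum_sum_mul_normSq_le hA U
      simp only [Finset.sum_sub_distrib]
      linarith
  all_goals intros; exact integrable_of_continuous_unitaryGroup (by fun_prop)

theorem integral_re_overlap_sq (hinv : ∀ V : unitaryGroup n ℂ, μ.map (fun U => V * U) = μ)
    {A : Matrix n n ℂ} (hA : A.IsHermitian) (htr : trace A = 0) (x : n) :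
    (Fintype.card n : ℝ) * (Fintype.card n + 1) * ∫ U, (overlap A x U).re ^ 2 ∂μ =
      (trace (A ^ 2)).re := by
  have h1 := integral_re_overlap_pow_mul_pow hinv hA x 1 1
  have h2 := integral_re_overlap_pow_mul_pow hinv hA x 2 0
  simp only [htr, pow_one, pow_zero, mul_one, integral_const, probReal_univ, smul_eq_mul,
    Nat.cast_one, Nat.cast_zero, ← pow_two, Complex.zero_re, zero_mul, one_mul, zero_add, add_zero,
    Nat.reduceAdd, Nat.reduceSub] at h1 h2
  linear_combination (Fintype.card n : ℝ) * h1 + h2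

theorem integral_re_overlap_sq_mul_sq_le
    (hinv : ∀ V : unitaryGroup n ℂ, μ.map (fun U => V * U) = μ)
    {A : Matrix n n ℂ} (hA : A.IsHermitian) (htr : trace A = 0) (x : n) :
    (Fintype.card n : ℝ) * (Fintype.card n + 1) * (Fintype.card n + 2) *
        ∫ U, (overlap (A ^ 2) x U).re * (overlap A x U).re ^ 2 ∂μ ≤
      3 * (trace (A ^ 2)).re ^ 2 := by
  have h0 := integral_re_overlap_pow_mul_pow hinv hA x 1 0
  have h1 := integral_re_overlap_sq hinv hA htr x
  have h2 := integral_re_overlap_pow_mul_pow hinv hA x 2 2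
  have h3 := integral_re_overlap_pow_mul_pow hinv hA x 3 1
  have h4 := integral_re_overlap_pow_mul_pow hinv hA x 4 0
  simp only [htr, pow_one, pow_zero, mul_one, integral_const, probReal_univ, smul_eq_mul,
    Nat.cast_one, Nat.cast_zero, Nat.cast_ofNat, Complex.zero_re, zero_mul, one_mul, add_zero,
    Nat.reduceAdd, Nat.reduceSub] at h0 h2 h3 h4
  have := re_trace_pow_four_le hA
  have key : (Fintype.card n : ℝ) * (Fintype.card n + 1) * (Fintype.card n + 2) *
        ∫ U, (overlap (A ^ 2) x U).re * (overlap A x U).re ^ 2 ∂μ =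
      (trace (A ^ 2)).re ^ 2 + 2 * (trace (A ^ 4)).re := by
    linear_combination (Fintype.card n : ℝ) * (Fintype.card n + 1) * h2
      + (trace (A ^ 2)).re * h1 + 2 * (Fintype.card n : ℝ) * h3 + 2 * h4 + 2 * (trace (A ^ 3)).re * h0
  linarith

theorem integral_re_overlap_pow_four_le
    (hinv : ∀ V : unitaryGroup n ℂ, μ.map (fun U => V * U) = μ)
    {A : Matrix n n ℂ} (hA : A.IsHermitian) (htr : trace A = 0) (x : n) :
    (Fintype.card n : ℝ) * (Fintype.card n + 1) * (Fintype.card n + 2) * (Fintype.card n + 3) *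
        ∫ U, (overlap A x U).re ^ 4 ∂μ ≤ 9 * (trace (A ^ 2)).re ^ 2 := by
  have h1 := integral_re_overlap_sq_mul_sq_le hinv hA htr x
  have h2 := integral_re_overlap_pow_mul_pow hinv hA x 1 3
  simp only [htr, pow_one, ← pow_succ', Complex.zero_re, zero_mul, zero_add, Nat.cast_ofNat,
    Nat.reduceAdd, Nat.reduceSub] at h2
  linear_combination 3 * h1
    + (Fintype.card n : ℝ) * (Fintype.card n + 1) * (Fintype.card n + 2) * h2

theorem integral_sum_re_overlap_sq (hinv : ∀ V : unitaryGroup n ℂ, μ.map (fun U => V * U) = μ)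
    {A : Matrix n n ℂ} (hA : A.IsHermitian) (htr : trace A = 0) [Nonempty n] :
    ∫ U, ∑ x, (overlap A x U).re ^ 2 ∂μ = (trace (A ^ 2)).re / ((Fintype.card n : ℝ) + 1) := by
  have hN : (0 : ℝ) < Fintype.card n := by exact_mod_cast Fintype.card_pos
  have h (x : n) : ∫ U, (overlap A x U).re ^ 2 ∂μ =
      (trace (A ^ 2)).re / ((Fintype.card n : ℝ) * (Fintype.card n + 1)) := by
    rw [eq_div_iff (by positivity), mul_comm, integral_re_overlap_sq hinv hA htr x]
  rw [integral_finsetSum _ fun x _ => integrable_of_continuous_unitaryGroup (by fun_prop)]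
  simp only [h, Finset.sum_const, Finset.card_univ, nsmul_eq_mul]
  field_simp

theorem integral_sum_re_overlap_sq_sub_sq_le
    (hinv : ∀ V : unitaryGroup n ℂ, μ.map (fun U => V * U) = μ)
    {A : Matrix n n ℂ} (hA : A.IsHermitian) (htr : trace A = 0) [Nonempty n] :
    ∫ U, (∑ x, (overlap A x U).re ^ 2
        - (trace (A ^ 2)).re / ((Fintype.card n : ℝ) + 1)) ^ 2 ∂μ ≤
      12 * (trace (A ^ 2)).re ^ 2 / (((Fintype.card n : ℝ) + 1) ^ 2 * (Fintype.card n + 2)) := by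
  have hN : (0 : ℝ) < Fintype.card n := by exact_mod_cast Fintype.card_pos
  have hq := integral_sum_re_overlap_sq hinv hA htr
  have hqq := integral_sum_re_overlap_sq_sq_le hinv hA htr
  have hw : ∑ x, ∫ U, (overlap (A ^ 2) x U).re * (overlap A x U).re ^ 2 ∂μ ≤
      3 * (trace (A ^ 2)).re ^ 2 / (((Fintype.card n : ℝ) + 1) * (Fintype.card n + 2)) := by
    calc _ ≤ ∑ x : n, 3 * (trace (A ^ 2)).re ^ 2 /
          ((Fintype.card n : ℝ) * (Fintype.card n + 1) * (Fintype.card n + 2)) :=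
          Finset.sum_le_sum fun x _ => by
            rw [le_div_iff₀' (by positivity)]
            exact integral_re_overlap_sq_mul_sq_le hinv hA htr x
      _ = _ := by
        simp only [Finset.sum_const, Finset.card_univ, nsmul_eq_mul]
        field_simp
  set m := (trace (A ^ 2)).re / ((Fintype.card n : ℝ) + 1) with hm
  have hexp : ∫ U, (∑ x, (overlap A x U).re ^ 2 - m) ^ 2 ∂μ =
      ∫ U, (∑ x, (overlap A x U).re ^ 2) ^ 2 ∂μ - m ^ 2 := by
    have : ∀ U : unitaryGroup n ℂ, (∑ x, (overlap A x U).re ^ 2 - m) ^ 2 =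
        (∑ x, (overlap A x U).re ^ 2) ^ 2 - 2 * m * ∑ x, (overlap A x U).re ^ 2 + m ^ 2 :=
      fun U => by ring
    simp only [this]
    rw [integral_add, integral_sub, integral_const_mul, hq]
    · simp only [integral_const, probReal_univ, smul_eq_mul]
      ring
    all_goals exact integrable_of_continuous_unitaryGroup (by fun_prop)
  rw [hexp]
  rw [hq] at hqq
  refine le_of_mul_le_mul_left ?_ (by positivity : (0 : ℝ) < (Fintype.card n : ℝ) + 1)
  calc _ ≤ 4 * (3 * (trace (A ^ 2)).re ^ 2 /
          (((Fintype.card n : ℝ) + 1) * (Fintype.card n + 2))) := by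
        have : ((Fintype.card n : ℝ) + 1) * m ^ 2 = (trace (A ^ 2)).re * m := by
          rw [hm]; field_simp
        linarith
    _ = _ := by field_simp; ring

theorem integral_sum_re_overlap_pow_four_le
    (hinv : ∀ V : unitaryGroup n ℂ, μ.map (fun U => V * U) = μ)
    {A : Matrix n n ℂ} (hA : A.IsHermitian) (htr : trace A = 0) [Nonempty n] :
    ∫ U, ∑ x, (overlap A x U).re ^ 4 ∂μ ≤
      9 * (trace (A ^ 2)).re ^ 2 / ((Fintype.card n : ℝ) + 1) ^ 3 := by
  have hN : (0 : ℝ) < Fintype.card n := by exact_mod_cast Fintype.card_pos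
  rw [integral_finsetSum _ fun x _ => integrable_of_continuous_unitaryGroup (by fun_prop)]
  calc _ ≤ ∑ x : n, 9 * (trace (A ^ 2)).re ^ 2 /
        ((Fintype.card n : ℝ) * (Fintype.card n + 1) * (Fintype.card n + 2) *
          (Fintype.card n + 3)) :=
        Finset.sum_le_sum fun x _ => by
          rw [le_div_iff₀' (by positivity)]
          exact integral_re_overlap_pow_four_le hinv hA htr x
    _ = 9 * (trace (A ^ 2)).re ^ 2 /
        (((Fintype.card n : ℝ) + 1) * (Fintype.card n + 2) * (Fintype.card n + 3)) := by
      simp only [Finset.sum_const, Finset.card_univ, nsmul_eq_mul]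
      field_simp
    _ ≤ _ := by
      gcongr
      rw [pow_three]
      nlinarith

/-- With probability at least `0.9`, the second moment `∑ x, ⟨u_x, A u_x⟩ ^ 2` is at least a tenth
of its mean while the fourth moment `∑ x, ⟨u_x, A u_x⟩ ^ 4` is of the order of its mean. -/
theorem le_measure_re_overlap_moments
    (hinv : ∀ V : unitaryGroup n ℂ, μ.map (fun U => V * U) = μ)
    {A : Matrix n n ℂ} (hA : A.IsHermitian) (htr : trace A = 0) (hn : 200 ≤ Fintype.card n)
    (hpos : 0 < (trace (A ^ 2)).re) :
    ENNReal.ofReal 0.9 ≤ μ {U |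
      0.1 * (trace (A ^ 2)).re / ((Fintype.card n : ℝ) + 1) ≤ ∑ x, (overlap A x U).re ^ 2 ∧
      ∑ x, (overlap A x U).re ^ 4 ≤
        350 * (trace (A ^ 2)).re ^ 2 / ((Fintype.card n : ℝ) + 1) ^ 3} := by
  have : Nonempty n := Fintype.card_pos_iff.1 (by omega)
  have hN : (200 : ℝ) ≤ Fintype.card n := by exact_mod_cast hn
  have hq := integral_sum_re_overlap_sq_sub_sq_le hinv hA htr
  have hr := integral_sum_re_overlap_pow_four_le hinv hA htr
  set F := (trace (A ^ 2)).re
  set N : ℝ := (Fintype.card n : ℝ)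
  set f : unitaryGroup n ℂ → ℝ := fun U =>
    (∑ x, (overlap A x U).re ^ 2 - F / (N + 1)) ^ 2 * ((N + 1) ^ 2 / (0.81 * F ^ 2))
      + (∑ x, (overlap A x U).re ^ 4) * ((N + 1) ^ 3 / (350 * F ^ 2)) with hf
  have hcont : Continuous f := by fun_prop
  have hf0 (U : unitaryGroup n ℂ) : 0 ≤ f U := by positivity
  have hint : ∫ U, f U ∂μ ≤ 0.1 := by
    rw [hf, integral_add, integral_mul_const, integral_mul_const]
    · calc _ ≤ 12 * F ^ 2 / ((N + 1) ^ 2 * (N + 2)) * ((N + 1) ^ 2 / (0.81 * F ^ 2))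
            + 9 * F ^ 2 / (N + 1) ^ 3 * ((N + 1) ^ 3 / (350 * F ^ 2)) := by gcongr
        _ = 12 / 0.81 / (N + 2) + 9 / 350 := by field_simp
        _ ≤ 12 / 0.81 / (200 + 2) + 9 / 350 := by gcongr
        _ ≤ _ := by norm_num
    all_goals exact integrable_of_continuous_unitaryGroup (by fun_prop)
  have hmarkov := mul_meas_ge_le_integral_of_nonneg (.of_forall hf0)
    (integrable_of_continuous_unitaryGroup (μ := μ) hcont) 1
  have hsub : {U | 1 ≤ f U}ᶜ ⊆ {U | 0.1 * F / (N + 1) ≤ ∑ x, (overlap A x U).re ^ 2 ∧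
      ∑ x, (overlap A x U).re ^ 4 ≤ 350 * F ^ 2 / (N + 1) ^ 3} := by
    intro U hU
    have hU : f U < 1 := not_le.1 hU
    simp only [hf] at hU
    have h1 : 0 ≤ (∑ x, (overlap A x U).re ^ 2 - F / (N + 1)) ^ 2 *
      ((N + 1) ^ 2 / (0.81 * F ^ 2)) := by positivity
    have h2 : 0 ≤ (∑ x, (overlap A x U).re ^ 4) * ((N + 1) ^ 3 / (350 * F ^ 2)) := by positivity
    have h3 : (∑ x, (overlap A x U).re ^ 2 - F / (N + 1)) ^ 2 *
        ((N + 1) ^ 2 / (0.81 * F ^ 2)) ≤ 1 := by linarith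
    have h4 : (∑ x, (overlap A x U).re ^ 4) * ((N + 1) ^ 3 / (350 * F ^ 2)) ≤ 1 := by linarith
    constructor
    · rw [← le_div_iff₀ (by positivity), one_div_div,
        show 0.81 * F ^ 2 / (N + 1) ^ 2 = (0.9 * F / (N + 1)) ^ 2 by rw [div_pow, mul_pow]; norm_num]
        at h3
      have := (abs_le_of_sq_le_sq' h3 (by positivity)).1
      have e : 0.1 * F / (N + 1) = F / (N + 1) - 0.9 * F / (N + 1) := by ring
      linarith
    · rwa [← le_div_iff₀ (by positivity), one_div_div] at h4
  refine le_trans ?_ (measure_mono hsub)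
  rw [← ofReal_measureReal, probReal_compl_eq_one_sub]
  · apply ENNReal.ofReal_le_ofReal
    linarith
  · exact (isClosed_le continuous_const hcont).measurableSet

end

/-- If `∑ a_x ^ 2` is large and `∑ a_x ^ 4` is small then `∑ |a_x|` is large. -/
theorem le_sum_abs_of_sum_sq_of_sum_pow_four {ι : Type*} (s : Finset ι) (a : ι → ℝ) {L : ℝ}
    (hL : 0 < L) :
    (∑ x ∈ s, a x ^ 2) / L - (∑ x ∈ s, a x ^ 4) / L ^ 3 ≤ ∑ x ∈ s, |a x| := by
  rw [Finset.sum_div, Finset.sum_div, ← Finset.sum_sub_distrib]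
  refine Finset.sum_le_sum fun x _ => ?_
  have ht : ∀ t : ℝ, 0 ≤ t → t ^ 2 - t ^ 4 ≤ t := fun t ht => by
    nlinarith [mul_nonneg ht (sq_nonneg (t - 1)), mul_nonneg ht (sq_nonneg (t + 1)),
      mul_nonneg (mul_nonneg ht ht) (sq_nonneg (t - 1)), pow_nonneg ht 3, sq_nonneg (t - 1)]
  have h := mul_le_mul_of_nonneg_left (ht (|a x| / L) (by positivity)) hL.le
  have e : L * (|a x| / L) = |a x| := by field_simp
  rw [e, div_pow, div_pow, sq_abs, (by decide : Even 4).pow_abs] at h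
  refine le_trans (le_of_eq ?_) h
  field_simp

theorem star_dotProduct_mulVec_col (A : Matrix n n ℂ) (x : n) (U : unitaryGroup n ℂ) :
    star (fun j => (U : Matrix n n ℂ) j x) ⬝ᵥ A.mulVec (fun j => (U : Matrix n n ℂ) j x) =
      overlap A x U := by
  rw [overlap, Matrix.mul_assoc]
  simp only [dotProduct, mulVec, Matrix.mul_apply, conjTranspose_apply, Pi.star_apply]

/-- for `d ≥ 200` and density matrices `ρ, σ`, with Haar probability
at least 0.9 the ℓ₁ distance between the outcome distributions of the random basis
measurement applied to `ρ` and `σ` is at least `(0.0049/(3e))·‖ρ−σ‖_F/ln d`.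
Haar measure on the unitary group is encoded as a left-invariant Borel
probability measure `μ`; `u_x` is the `x`-th column of `U`. -/
theorem haar_basis_l1_lower_bound
    {d : ℕ} (hd : 200 ≤ d)
    [MeasurableSpace (Matrix.unitaryGroup (Fin d) ℂ)]
    [BorelSpace (Matrix.unitaryGroup (Fin d) ℂ)]
    (μ : Measure (Matrix.unitaryGroup (Fin d) ℂ)) [IsProbabilityMeasure μ]
    (hinv : ∀ V : Matrix.unitaryGroup (Fin d) ℂ, μ.map (fun U => V * U) = μ)
    (ρ σ : Matrix (Fin d) (Fin d) ℂ)
    (hρ : ρ.PosSemidef) (hρtr : ρ.trace = 1)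
    (hσ : σ.PosSemidef) (hσtr : σ.trace = 1) :
    ENNReal.ofReal 0.9 ≤
      μ {U : Matrix.unitaryGroup (Fin d) ℂ |
        (0.0049 / (3 * Real.exp 1))
            * Real.sqrt (((ρ - σ) * (ρ - σ)).trace.re) / Real.log d
        ≤ ∑ x : Fin d,
            |(star (fun j => (U : Matrix (Fin d) (Fin d) ℂ) j x)
              ⬝ᵥ (ρ - σ).mulVec (fun j => (U : Matrix (Fin d) (Fin d) ℂ) j x)).re|} := by
  have hA : (ρ - σ).IsHermitian := hρ.isHermitian.sub hσ.isHermitian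
  have htr : (ρ - σ).trace = 0 := by rw [trace_sub, hρtr, hσtr, sub_self]
  simp only [star_dotProduct_mulVec_col, ← pow_two]
  set A := ρ - σ
  have hF : 0 ≤ (trace (A ^ 2)).re := by rw [re_trace_sq hA]; positivity
  rcases hF.eq_or_lt with hF | hF
  · have huniv : {U : unitaryGroup (Fin d) ℂ | 0.0049 / (3 * Real.exp 1) *
        Real.sqrt (A ^ 2).trace.re / Real.log d ≤ ∑ x, |(overlap A x U).re|} = Set.univ := by
      refine Set.eq_univ_of_forall fun U => ?_
      rw [Set.mem_ofPred_eq, ← hF, Real.sqrt_zero, mul_zero, zero_div]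
      positivity
    rw [huniv, measure_univ]
    exact ENNReal.ofReal_le_one.2 (by norm_num)
  refine (le_measure_re_overlap_moments hinv hA htr (by simpa using hd) hF).trans
    (measure_mono fun U ⟨hq, hr⟩ => ?_)
  rw [Fintype.card_fin] at hq hr
  rw [Set.mem_ofPred_eq]
  obtain ⟨s, hs, hsF⟩ : ∃ s : ℝ, 0 < s ∧ (trace (A ^ 2)).re = s ^ 2 :=
    ⟨_, Real.sqrt_pos.2 hF, (Real.sq_sqrt hF.le).symm⟩
  rw [hsF] at hq hr ⊢
  rw [Real.sqrt_sq hs.le]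
  have hd' : (200 : ℝ) ≤ d := by exact_mod_cast hd
  have hlog : 1 ≤ Real.log d := by
    rw [Real.le_log_iff_exp_le (by linarith)]
    linarith [Real.exp_one_lt_d9]
  have hL : 0 < 100 * s / (d + 1 : ℝ) := by positivity
  calc 0.0049 / (3 * Real.exp 1) * s / Real.log d
      ≤ 0.0049 / (3 * Real.exp 1) * s := div_le_self (by positivity) hlog
    _ ≤ 0.0049 / (3 * 2.7) * s := by
      gcongr
      linarith [Real.exp_one_gt_d9]
    _ ≤ 0.00065 * s := by gcongr; norm_num
    _ = 0.1 * s ^ 2 / (d + 1) / (100 * s / (d + 1))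
        - 350 * (s ^ 2) ^ 2 / (d + 1) ^ 3 / (100 * s / (d + 1)) ^ 3 := by
      field_simp
      norm_num
    _ ≤ (∑ x, (overlap A x U).re ^ 2) / (100 * s / (d + 1))
        - (∑ x, (overlap A x U).re ^ 4) / (100 * s / (d + 1)) ^ 3 := by gcongr
    _ ≤ _ := le_sum_abs_of_sum_sq_of_sum_pow_four _ _ hL
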